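/- Let Λ be a commutative Noetherian regular local ring and M a finitely generated Λ-module with pd_Λ(M) ≤ 1. Then M has no nonzero pseudo-null submodule: if N ⊆ M is a submodule such that the localization N_q vanishes for every prime ideal q of Λ of height at most 1, then N = 0. -/

import Mathlib

noncomputable section

/-- `Λ` is a regular local ring: its maximal ideal is generated by `dim Λ` elements. -/
def IsRegularLocal (Λ : Type) [CommRing Λ] [IsLocalRing Λ] : Prop :=
  ∃ s : Finset Λ, Ideal.span (s : Set Λ) = IsLocalRing.maximalIdeal Λ ∧
    (s.card : WithBot (WithTop ℕ)) = ringKrullDim Λ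

/-- A prime ideal `q` has height at most one: there is no chain of primes
`q₀ < q₁ < q`. -/
def HeightLEOne (Λ : Type) [CommRing Λ] (q : Ideal Λ) : Prop :=
  ¬ ∃ q₀ q₁ : Ideal Λ, q₀.IsPrime ∧ q₁.IsPrime ∧ q₀ < q₁ ∧ q₁ < q

/-- A finitely generated module has projective dimension at most one: some (equivalently,
any) surjection from a finite free module has projective kernel. -/
def ProjDimLEOne (𝓡 : Type) [CommRing 𝓡] (M : Type) [AddCommGroup M] [Module 𝓡 M] :
    Prop :=
  ∃ (n : ℕ) (φ : (Fin n → 𝓡) →ₗ[𝓡] M),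
    Function.Surjective φ ∧ Module.Projective 𝓡 (LinearMap.ker φ)

open IsLocalRing Ideal

theorem IsRegularLocalRing.of_isRegularLocal {R : Type} [CommRing R] [IsNoetherianRing R]
    [IsLocalRing R] (h : IsRegularLocal R) : IsRegularLocalRing R := by
  obtain ⟨s, hs, hcard⟩ := h
  apply IsRegularLocalRing.of_spanFinrank_maximalIdeal_le
  have hcard' : (s.card : WithBot ℕ∞) = ringKrullDim R := hcard
  rw [← hcard', ← hs]
  have := Submodule.spanFinrank_span_le_ncard_of_finite (R := R) s.finite_toSet
  rw [Set.ncard_coe_finset] at this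
  change (span _).spanFinrank ≤ _ at this
  exact_mod_cast this

section RegularLocalRing

universe u

variable {R : Type u} [CommRing R]

theorem IsLocalRing.exists_generator_mem_span_diff [IsLocalRing R] {s : Finset R}
    (hs : span (s : Set R) = maximalIdeal R) {x : R} (hx : x ∈ maximalIdeal R)
    (hx2 : x ∉ maximalIdeal R ^ 2) :
    ∃ y ∈ s, maximalIdeal R ≤ span {x} ⊔ span ((s : Set R) \ {y}) := by
  classical
  rw [← hs] at hx
  obtain ⟨f, -, hf⟩ := Submodule.mem_span_finset.1 hx
  have hu : ∃ y ∈ s, IsUnit (f y) := by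
    by_contra! hcon
    refine hx2 (hf ▸ Submodule.sum_mem _ fun y hy => ?_)
    rw [pow_two]
    exact Ideal.mul_mem_mul ((mem_maximalIdeal _).2 (hcon y hy)) (hs ▸ subset_span hy)
  obtain ⟨y, hy, hfy⟩ := hu
  refine ⟨y, hy, ?_⟩
  rw [← hs, span_le]
  intro z hz
  by_cases hzy : z = y
  · subst hzy
    rw [SetLike.mem_coe, ← Ideal.unit_mul_mem_iff_mem _ hfy]
    rw [← Finset.add_sum_erase _ _ hy] at hf
    rw [← smul_eq_mul, eq_sub_of_add_eq hf]
    refine sub_mem (Ideal.mem_sup_left (mem_span_singleton_self x))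
      (Ideal.mem_sup_right (sum_mem fun w hw => Ideal.mul_mem_left _ _ (subset_span ?_)))
    rw [Finset.mem_erase] at hw
    exact ⟨hw.2, hw.1⟩
  · exact Ideal.mem_sup_right (subset_span ⟨hz, hzy⟩)

theorem IsRegularLocalRing.quotient_span_singleton [IsRegularLocalRing R] {x : R}
    (hx : x ∈ maximalIdeal R) (hx2 : x ∉ maximalIdeal R ^ 2) :
    IsRegularLocalRing (R ⧸ span {x}) ∧ ringKrullDim (R ⧸ span {x}) + 1 = ringKrullDim R := by
  classical
  have hne : span {x} ≠ ⊤ := fun h =>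
    (maximalIdeal.isMaximal R).ne_top (top_le_iff.1 (h ▸ (span_singleton_le_iff_mem _).2 hx))
  have : Nontrivial (R ⧸ span {x}) := Ideal.Quotient.nontrivial_iff.2 hne
  have hsurj : Function.Surjective (Ideal.Quotient.mk (span {x})) := Ideal.Quotient.mk_surjective
  have : IsLocalRing (R ⧸ span {x}) := .of_surjective' _ hsurj
  have hfg : (maximalIdeal R).FG := IsNoetherian.noetherian _
  let s := (Submodule.FG.finite_generators hfg).toFinset
  have hscoe : (s : Set R) = (maximalIdeal R).generators := Set.Finite.coe_toFinset _
  have hs : span (s : Set R) = maximalIdeal R := by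
    rw [hscoe]; exact Submodule.span_generators _
  have hcard : (s.card : WithBot ℕ∞) = ringKrullDim R := by
    rw [← Set.ncard_coe_finset, hscoe, Submodule.FG.generators_ncard hfg,
      IsRegularLocalRing.spanFinrank_maximalIdeal]
  obtain ⟨y, hy, hle⟩ := exists_generator_mem_span_diff hs hx hx2
  have hmap : maximalIdeal (R ⧸ span {x}) ≤
      span (((s.erase y).image (Ideal.Quotient.mk (span {x})) : Finset _) : Set _) := by
    intro z hz
    obtain ⟨z, rfl⟩ := hsurj z
    have hz' : z ∈ maximalIdeal R := by
      rw [mem_maximalIdeal, mem_nonunits_iff] at hz ⊢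
      exact fun h => hz (h.map _)
    have := Ideal.mem_map_of_mem (Ideal.Quotient.mk (span {x})) (hle hz')
    rw [Ideal.map_sup, Ideal.map_quotient_self, bot_sup_eq, Ideal.map_span] at this
    simpa using this
  have hmap' : span (((s.erase y).image (Ideal.Quotient.mk (span {x})) : Finset _) : Set _) =
      maximalIdeal (R ⧸ span {x}) := by
    refine le_antisymm (span_le.2 ?_) hmap
    intro z hz
    simp only [Finset.coe_image, Set.mem_image, Finset.mem_coe, Finset.mem_erase] at hz
    obtain ⟨w, ⟨-, hw⟩, rfl⟩ := hz
    have hwm : w ∈ maximalIdeal R := hs ▸ subset_span hw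
    have hxj : span {x} ≤ maximalIdeal R := (span_singleton_le_iff_mem _).2 hx
    rw [SetLike.mem_coe, mem_maximalIdeal, mem_nonunits_iff]
    intro hu
    obtain ⟨v, hv⟩ := hsurj (↑(hu.unit⁻¹))
    have h1 : Ideal.Quotient.mk (span {x}) (w * v) = Ideal.Quotient.mk (span {x}) 1 := by
      rw [map_mul, hv, map_one]; exact hu.mul_val_inv
    have h2 := hxj (Ideal.Quotient.eq.1 h1)
    have h3 : (1 : R) ∈ maximalIdeal R := by
      simpa using sub_mem (Ideal.mul_mem_right v _ hwm) h2
    exact (maximalIdeal.isMaximal R).ne_top ((eq_top_iff_one _).2 h3)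
  have hrank : (maximalIdeal (R ⧸ span {x})).spanFinrank + 1 ≤ s.card := by
    have h1 := Submodule.spanFinrank_span_le_ncard_of_finite (R := R ⧸ span {x})
      (((s.erase y).image (Ideal.Quotient.mk (span {x})))).finite_toSet
    rw [Set.ncard_coe_finset] at h1
    change (span _).spanFinrank ≤ _ at h1
    rw [hmap'] at h1
    have h2 := Finset.card_image_le (s := s.erase y) (f := Ideal.Quotient.mk (span {x}))
    have h3 := Finset.card_erase_add_one hy
    omega
  have hdim := ringKrullDim_le_ringKrullDim_quotient_add_card ({x} : Finset R) (by
    rw [ringJacobson_eq_maximalIdeal]; simpa using hx)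
  simp only [Finset.card_singleton, Nat.cast_one] at hdim
  rw [Finset.coe_singleton] at hdim
  have hle' := ringKrullDim_le_spanFinrank_maximalIdeal (R := R ⧸ span {x})
  rw [← hcard] at hdim ⊢
  rw [isRegularLocalRing_iff]
  have hnb := ringKrullDim_ne_bot (R := R ⧸ span {x})
  have hnt := ringKrullDim_ne_top (R := R ⧸ span {x})
  generalize ringKrullDim (R ⧸ span {x}) = e at *
  lift e to ℕ∞ using hnb
  lift e to ℕ using (by simpa using hnt)
  norm_cast at *
  omega

theorem IsRegularLocalRing.isDomain_of_ringKrullDim_eq (n : ℕ) :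
    ∀ (R : Type u) [CommRing R] [IsRegularLocalRing R], ringKrullDim R = n → IsDomain R := by
  induction n with
  | zero =>
    intro R _ _ hd
    have h0 := IsRegularLocalRing.spanFinrank_maximalIdeal (R := R)
    rw [hd] at h0
    have hm : maximalIdeal R = ⊥ :=
      (Submodule.spanFinrank_eq_zero_iff_eq_bot (IsNoetherian.noetherian _)).1 (by exact_mod_cast h0)
    exact (isField_iff_maximalIdeal_eq.2 hm).isDomain
  | succ n ih =>
    intro R _ _ hd
    have hfin := minimalPrimes.finite_of_isNoetherianRing R
    have hmmin : maximalIdeal R ∉ minimalPrimes R := by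
      rw [← Ideal.height_eq_zero_iff]
      intro h
      have := maximalIdeal_height_eq_ringKrullDim (R := R)
      rw [h, hd] at this
      norm_cast at this
    have hm2 : ¬ maximalIdeal R ≤ maximalIdeal R ^ 2 := by
      intro h
      have : maximalIdeal R ≤ ⊥ := Submodule.le_of_le_smul_of_le_jacobson_bot
        (IsNoetherian.noetherian _) (maximalIdeal_le_jacobson _) (by
          rwa [bot_sup_eq, smul_eq_mul, ← pow_two])
      have h0 := IsRegularLocalRing.spanFinrank_maximalIdeal (R := R)
      rw [le_bot_iff.1 this, hd] at h0
      simp at h0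
      norm_cast at h0
    obtain ⟨x, hx, hx2, hxmin⟩ : ∃ x ∈ maximalIdeal R, x ∉ maximalIdeal R ^ 2 ∧
        ∀ q ∈ minimalPrimes R, x ∉ q := by
      by_contra! hcon
      have hsub : (maximalIdeal R : Set R) ⊆
          ⋃ q ∈ ((insert (maximalIdeal R ^ 2) hfin.toFinset : Finset (Ideal R)) : Set (Ideal R)),
            ((id q : Ideal R) : Set R) := by
        intro x hx
        by_cases hx2 : x ∈ maximalIdeal R ^ 2
        · exact Set.mem_biUnion (by simp) hx2
        · obtain ⟨q, hq, hxq⟩ := hcon x hx hx2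
          exact Set.mem_biUnion (by simp [hq]) hxq
      rw [Ideal.subset_union_prime (maximalIdeal R ^ 2) (maximalIdeal R ^ 2)] at hsub
      · obtain ⟨q, hq, hle⟩ := hsub
        simp only [Finset.mem_insert, Set.Finite.mem_toFinset, id] at hq hle
        rcases hq with rfl | hq
        · exact hm2 hle
        · exact hmmin ((le_maximalIdeal hq.1.1.ne_top).antisymm hle ▸ hq)
      · intro q hq hne _
        simp only [Finset.mem_insert, Set.Finite.mem_toFinset, hne, false_or] at hq
        exact hq.1.1
    obtain ⟨hreg, hdim⟩ := quotient_span_singleton hx hx2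
    have hdom : IsDomain (R ⧸ span {x}) := by
      refine ih _ ?_
      rw [hd] at hdim
      have hnb := ringKrullDim_ne_bot (R := R ⧸ span {x})
      have hnt := ringKrullDim_ne_top (R := R ⧸ span {x})
      generalize ringKrullDim (R ⧸ span {x}) = e at *
      lift e to ℕ∞ using hnb
      lift e to ℕ using (by simpa using hnt)
      norm_cast at *
      omega
    have hprime : (span {x}).IsPrime := (Ideal.Quotient.isDomain_iff_prime _).1 hdom
    obtain ⟨q, hq, hqx⟩ := Ideal.exists_minimalPrimes_le (J := span {x}) bot_le
    have hqp : q.IsPrime := hq.1.1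
    have hq0 : q ≤ ⊥ := Submodule.le_of_le_smul_of_le_jacobson_bot
      (I := maximalIdeal R) (IsNoetherian.noetherian _) (maximalIdeal_le_jacobson _) (by
        intro z hz
        obtain ⟨r, rfl⟩ := mem_span_singleton'.1 (hqx hz)
        rw [bot_sup_eq, smul_eq_mul, mul_comm r x]
        exact Ideal.mul_mem_mul hx ((hqp.mem_or_mem hz).resolve_right (hxmin q hq)))
    rw [le_bot_iff] at hq0
    subst hq0
    exact IsDomain.of_bot_isPrime R

theorem IsRegularLocalRing.exists_ringKrullDim_eq (R : Type u) [CommRing R]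
    [IsRegularLocalRing R] : ∃ n : ℕ, ringKrullDim R = n :=
  ⟨_, IsRegularLocalRing.spanFinrank_maximalIdeal.symm⟩

theorem IsRegularLocalRing.isDomain (R : Type u) [CommRing R] [IsRegularLocalRing R] :
    IsDomain R :=
  let ⟨n, hn⟩ := exists_ringKrullDim_eq R
  isDomain_of_ringKrullDim_eq n R hn

theorem Ideal.ringKrullDim_quotient_succ_le_of_lt {p I : Ideal R} [p.IsPrime] (h : p < I) :
    ringKrullDim (R ⧸ I) + 1 ≤ ringKrullDim (R ⧸ p) := by
  obtain ⟨r, hrI, hrp⟩ := SetLike.exists_of_lt h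
  refine ringKrullDim_succ_le_of_surjective (Ideal.Quotient.factor h.le)
    (Ideal.Quotient.factor_surjective h.le) (r := Ideal.Quotient.mk p r) ?_ ?_
  · exact mem_nonZeroDivisors_of_ne_zero fun h0 => hrp (Ideal.Quotient.eq_zero_iff_mem.1 h0)
  · simpa using Ideal.Quotient.eq_zero_iff_mem.2 hrI

theorem Ideal.ringKrullDim_quotient_anti {I J : Ideal R} (h : I ≤ J) :
    ringKrullDim (R ⧸ J) ≤ ringKrullDim (R ⧸ I) :=
  ringKrullDim_le_of_surjective _ (Ideal.Quotient.factor_surjective h)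

/-- An ideal annihilating a nonzero element of `R ⧸ (a)` lies in a prime that also annihilates some
nonzero element of `R ⧸ (a)`. -/
theorem Ideal.exists_isPrime_mul_mem_span_singleton [IsNoetherianRing R] {I : Ideal R} {a c : R}
    (hI : ∀ i ∈ I, i * c ∈ span {a}) (hc : c ∉ span {a}) :
    ∃ (p : Ideal R) (e : R), p.IsPrime ∧ I ≤ p ∧ (∀ i ∈ p, i * e ∈ span {a}) ∧ e ∉ span {a} := by
  obtain ⟨p, hp, hle⟩ := exists_le_isAssociatedPrime_of_isNoetherianRing R
    (Ideal.Quotient.mk (span {a}) c) (by rwa [Ne, Ideal.Quotient.eq_zero_iff_mem])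
  obtain ⟨hpp, e, he⟩ := isAssociatedPrime_iff.1 hp
  obtain ⟨e, rfl⟩ := Ideal.Quotient.mk_surjective e
  have key (i b : R) : i ∈ (⊥ : Submodule R (R ⧸ span {a})).colon {Ideal.Quotient.mk (span {a}) b} ↔
      i * b ∈ span {a} := by
    rw [Submodule.mem_colon_singleton, Submodule.mem_bot, ← Ideal.Quotient.eq_zero_iff_mem, map_mul]
    rfl
  refine ⟨p, e, hpp, fun i hi => hle ((key i c).2 (hI i hi)), fun i hi => (key i e).1 (he ▸ hi),
    fun h => hpp.ne_top ((eq_top_iff_one _).2 ?_)⟩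
  rw [he, key, one_mul]
  exact h

/-- Exchange of denominators: the fractions `c / a` with `I • (c / a) ⊆ R` may be rewritten with any
denominator `b ∈ I`. -/
theorem Ideal.mem_span_singleton_of_exchange [IsDomain R] {I : Ideal R} {a b c : R} (ha : a ≠ 0)
    (hb : b ∈ I) (hb0 : b ≠ 0) (hI : ∀ i ∈ I, i * c ∈ span {a})
    (h : ∀ e, (∀ i ∈ I, i * e ∈ span {b}) → e ∈ span {b}) : c ∈ span {a} := by
  simp only [mem_span_singleton'] at *
  obtain ⟨e, he⟩ := hI b hb
  obtain ⟨t, ht⟩ := h e fun i hi => by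
    obtain ⟨r, hr⟩ := hI i hi
    refine ⟨r, mul_right_cancel₀ ha ?_⟩
    linear_combination b * hr - i * he
  refine ⟨t, mul_right_cancel₀ hb0 ?_⟩
  linear_combination a * ht + he

theorem IsRegularLocalRing.mem_span_singleton_of_ringKrullDim_eq (n : ℕ) :
    ∀ (R : Type u) [CommRing R] [IsRegularLocalRing R], ringKrullDim R = n → ∀ (I : Ideal R),
      ringKrullDim (R ⧸ I) + 2 ≤ ringKrullDim R → ∀ a c : R, a ≠ 0 →
      (∀ i ∈ I, i * c ∈ span {a}) → c ∈ span {a} := by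
  induction n with
  | zero =>
    intro R _ _ hd I hI a c ha hc
    rcases subsingleton_or_nontrivial (R ⧸ I) with h | h
    · have := Ideal.Quotient.subsingleton_iff.1 h
      simpa using hc 1 (this ▸ Submodule.mem_top)
    · have h0 := ringKrullDim_nonneg_of_nontrivial (R := R ⧸ I)
      have : (2 : WithBot ℕ∞) ≤ 0 := by
        calc (2 : WithBot ℕ∞) = 0 + 2 := by simp
          _ ≤ ringKrullDim (R ⧸ I) + 2 := by gcongr
          _ ≤ 0 := by simpa [hd] using hI
      norm_cast at this
  | succ n ih =>
    intro R _ _ hd I hI a c ha hc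
    have := IsRegularLocalRing.isDomain R
    by_contra hca
    obtain ⟨p, e, hp, hIp, hpe, hea⟩ := exists_isPrime_mul_mem_span_singleton hc hca
    refine hea ?_
    have hdp : ringKrullDim (R ⧸ p) + 2 ≤ ringKrullDim R :=
      le_trans (by gcongr; exact ringKrullDim_quotient_anti hIp) hI
    clear! I c
    obtain ⟨x, hx, hx2⟩ : ∃ x ∈ maximalIdeal R, x ∉ maximalIdeal R ^ 2 := by
      by_contra! h
      have : maximalIdeal R ≤ ⊥ := Submodule.le_of_le_smul_of_le_jacobson_bot
        (IsNoetherian.noetherian _) (maximalIdeal_le_jacobson _) (by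
          rw [bot_sup_eq, smul_eq_mul, ← pow_two]; exact h)
      have h0 := IsRegularLocalRing.spanFinrank_maximalIdeal (R := R)
      rw [le_bot_iff.1 this, hd] at h0
      simp at h0
      norm_cast at h0
    have hx0 : x ≠ 0 := fun h => hx2 (h ▸ zero_mem _)
    obtain ⟨hreg, hdim⟩ := quotient_span_singleton hx hx2
    have hdom := IsRegularLocalRing.isDomain (R ⧸ span {x})
    have hprime : (span {x}).IsPrime := (Ideal.Quotient.isDomain_iff_prime _).1 hdom
    obtain ⟨k, hk⟩ := exists_ringKrullDim_eq (R ⧸ span {x})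
    have hkn : k = n := by
      rw [hk, hd] at hdim
      norm_cast at hdim
      omega
    subst hkn
    have hpx : ¬ p ≤ span {x} := by
      intro h
      have h1 := ringKrullDim_quotient_anti h
      have h2 : ((k + 2 : ℕ) : WithBot ℕ∞) ≤ ((k + 1 : ℕ) : WithBot ℕ∞) := by
        rw [← hd]
        refine le_trans ?_ hdp
        rw [Nat.cast_add, ← hk]
        gcongr
        simp
      norm_cast at h2
      omega
    obtain ⟨b, hbp, hbx⟩ := SetLike.not_le_iff_exists.1 hpx
    have hb0 : b ≠ 0 := fun h => hbx (h ▸ zero_mem _)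
    by_cases hxp : x ∈ p
    · refine mem_span_singleton_of_exchange ha hxp hx0 hpe fun t ht => ?_
      exact (hprime.mem_or_mem (ht b hbp)).resolve_left hbx
    · refine mem_span_singleton_of_exchange ha hbp hb0 hpe ?_
      let C : Ideal R := (span {b}).colon (p : Set R)
      have hC (t : R) : t ∈ C ↔ ∀ i ∈ p, i * t ∈ span {b} := by
        simp [C, Submodule.mem_colon, mul_comm]
      suffices C ≤ span {b} from fun t ht => this ((hC t).2 ht)
      refine Submodule.le_of_le_smul_of_le_jacobson_bot (I := maximalIdeal R)
        (IsNoetherian.noetherian _) (maximalIdeal_le_jacobson _) fun t ht => ?_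
      rw [hC] at ht
      have hmem : Ideal.Quotient.mk (span {x}) t ∈ span {Ideal.Quotient.mk (span {x}) b} := by
        refine ih _ hk (p.map (Ideal.Quotient.mk (span {x}))) ?_ _ _ ?_ ?_
        · have h1 : ringKrullDim ((R ⧸ span {x}) ⧸ p.map (Ideal.Quotient.mk (span {x}))) + 1 ≤
              ringKrullDim (R ⧸ p) := by
            refine ringKrullDim_succ_le_of_surjective
              (Ideal.quotientMap _ (Ideal.Quotient.mk (span {x})) Ideal.le_comap_map)
              (Ideal.quotientMap_surjective Ideal.Quotient.mk_surjective)
              (r := Ideal.Quotient.mk p x) ?_ ?_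
            · exact mem_nonZeroDivisors_of_ne_zero fun h0 =>
                hxp (Ideal.Quotient.eq_zero_iff_mem.1 h0)
            · rw [Ideal.quotientMap_mk, Ideal.Quotient.eq_zero_iff_mem.2
                (mem_span_singleton_self x), map_zero]
          have h2 : ringKrullDim ((R ⧸ span {x}) ⧸ p.map (Ideal.Quotient.mk (span {x}))) + 1 + 2 ≤
              ringKrullDim (R ⧸ span {x}) + 1 := by
            rw [hdim]
            exact le_trans (by gcongr) hdp
          rw [hk] at h2 ⊢
          generalize ringKrullDim ((R ⧸ span {x}) ⧸ p.map (Ideal.Quotient.mk (span {x}))) = f at *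
          clear h1
          simp only [← one_add_one_eq_two, ← add_assoc] at h2 ⊢
          induction f with
          | bot => simp
          | coe f =>
            have hf : f ≠ ⊤ := by
              rintro rfl
              exact absurd h2 (by norm_cast)
            lift f to ℕ using hf
            norm_cast at h2 ⊢
            omega
        · rwa [Ne, Ideal.Quotient.eq_zero_iff_mem]
        · intro i hi
          obtain ⟨j, hj, rfl⟩ := (Ideal.mem_map_iff_of_surjective _
            Ideal.Quotient.mk_surjective).1 hi
          have := Ideal.mem_map_of_mem (Ideal.Quotient.mk (span {x})) (ht j hj)
          rwa [Ideal.map_span, Set.image_singleton, map_mul] at this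
      obtain ⟨r, hr⟩ := mem_span_singleton'.1 hmem
      obtain ⟨r, rfl⟩ := Ideal.Quotient.mk_surjective r
      rw [← map_mul] at hr
      obtain ⟨w, hw⟩ := mem_span_singleton'.1 (Ideal.Quotient.eq.1 hr.symm)
      have htw : t = r * b + x * w := by linear_combination -hw
      rw [htw]
      refine Submodule.add_mem_sup (mem_span_singleton'.2 ⟨r, rfl⟩)
        (Ideal.mul_mem_mul hx ((hC w).2 fun i hi => ?_))
      obtain ⟨v, hv⟩ := mem_span_singleton'.1 (ht i hi)
      have h1 : (v - i * r) * b ∈ span {x} :=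
        mem_span_singleton'.2 ⟨i * w, by rw [htw] at hv; linear_combination -hv⟩
      obtain ⟨z, hz⟩ := mem_span_singleton'.1 ((hprime.mem_or_mem h1).resolve_right hbx)
      refine mem_span_singleton'.2 ⟨z, mul_right_cancel₀ hx0 ?_⟩
      rw [htw] at hv
      linear_combination b * hz + hv

/-- If `dim R ⧸ I ≤ dim R - 2`, then every element `c / a` of the fraction field with
`I • (c / a) ⊆ R` lies in `R`. -/
theorem IsRegularLocalRing.mem_span_singleton_of_forall_mul_mem [IsRegularLocalRing R] {I : Ideal R}
    (hI : ringKrullDim (R ⧸ I) + 2 ≤ ringKrullDim R) {a c : R} (ha : a ≠ 0)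
    (hc : ∀ i ∈ I, i * c ∈ span {a}) : c ∈ span {a} :=
  let ⟨n, hn⟩ := exists_ringKrullDim_eq R
  mem_span_singleton_of_ringKrullDim_eq n R hn I hI a c ha hc

theorem IsRegularLocalRing.mem_of_forall_smul_mem [IsRegularLocalRing R] {I : Ideal R}
    (hI : ringKrullDim (R ⧸ I) + 2 ≤ ringKrullDim R) {F : Type*} [AddCommGroup F] [Module R F]
    [Module.IsTorsionFree R F] {K : Submodule R F} [Module.Free R K] {y : F}
    (hy : ∀ i ∈ I, i • y ∈ K) : y ∈ K := by
  have := IsRegularLocalRing.isDomain R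
  obtain ⟨a, haI, ha⟩ : ∃ a ∈ I, a ≠ 0 := by
    by_contra! h
    obtain ⟨n, hn⟩ := exists_ringKrullDim_eq R
    have hbot : I = ⊥ := (Submodule.eq_bot_iff _).2 h
    rw [hbot, ringKrullDim_eq_of_ringEquiv (RingEquiv.quotientBot R), hn] at hI
    norm_cast at hI
    omega
  let B := Module.Free.chooseBasis R K
  have hcoord (j) : ∃ t, t * a = B.repr ⟨a • y, hy a haI⟩ j := by
    rw [← mem_span_singleton']
    refine mem_span_singleton_of_forall_mul_mem hI ha fun i hi => ?_
    have h1 : i • (⟨a • y, hy a haI⟩ : K) = a • ⟨i • y, hy i hi⟩ :=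
      Subtype.ext (smul_comm i a y)
    have h2 := congrArg (fun z => B.repr z j) h1
    simp only [map_smul, Finsupp.smul_apply, smul_eq_mul] at h2
    rw [h2]
    exact mem_span_singleton'.2 ⟨_, mul_comm _ _⟩
  choose t ht using hcoord
  have h3 : (⟨a • y, hy a haI⟩ : K) =
      a • (B.repr ⟨a • y, hy a haI⟩).sum fun j _ => t j • B j := by
    conv_lhs => rw [← B.linearCombination_repr ⟨a • y, hy a haI⟩]
    rw [Finsupp.linearCombination_apply, Finsupp.smul_sum]
    exact Finsupp.sum_congr fun j _ => by rw [← ht j, smul_smul, mul_comm]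
  have h4 := congrArg Subtype.val h3
  rw [Submodule.coe_smul] at h4
  rw [smul_right_injective F ha h4]
  exact Subtype.property _

end RegularLocalRing

theorem HeightLEOne.of_not_ringKrullDim_le {R : Type} [CommRing R] {p : Ideal R}
    (h : ¬ ringKrullDim (R ⧸ p) + 2 ≤ ringKrullDim R) : HeightLEOne R p := by
  rintro ⟨q₀, q₁, h₀, h₁, h01, h1p⟩
  apply h
  calc ringKrullDim (R ⧸ p) + 2 = ringKrullDim (R ⧸ p) + 1 + 1 := by
        rw [add_assoc, one_add_one_eq_two]
    _ ≤ ringKrullDim (R ⧸ q₁) + 1 := by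
        gcongr; exact Ideal.ringKrullDim_quotient_succ_le_of_lt h1p
    _ ≤ ringKrullDim (R ⧸ q₀) := Ideal.ringKrullDim_quotient_succ_le_of_lt h01
    _ ≤ ringKrullDim R := ringKrullDim_quotient_le q₀

/-- Let `Λ` be a commutative Noetherian regular local ring and `M` a finitely generated
`Λ`-module with `pd_Λ(M) ≤ 1`.  Then `M` has no nonzero pseudo-null submodule:  if
`N ⊆ M` is a submodule whose localization `N_q` vanishes for every prime ideal `q` of
`Λ` of height at most one (i.e. every element of `N` is annihilated by some `s ∉ q`),
then `N = 0`. -/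
theorem pseudoNull_submodule_eq_bot
    (Λ : Type) [CommRing Λ] [IsNoetherianRing Λ] [IsLocalRing Λ]
    (hreg : IsRegularLocal Λ)
    (M : Type) [AddCommGroup M] [Module Λ M] [Module.Finite Λ M]
    (hpd : ProjDimLEOne Λ M)
    (N : Submodule Λ M)
    (hN : ∀ q : Ideal Λ, q.IsPrime → HeightLEOne Λ q →
      ∀ x ∈ N, ∃ s : Λ, s ∉ q ∧ s • x = 0) :
    N = ⊥ := by
  have := IsRegularLocalRing.of_isRegularLocal hreg
  have := IsRegularLocalRing.isDomain Λ
  obtain ⟨n, φ, hφ, hproj⟩ := hpd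
  have : Module.Free Λ (LinearMap.ker φ) := Module.free_of_flat_of_isLocalRing
  rw [Submodule.eq_bot_iff]
  intro x hx
  by_contra hx0
  obtain ⟨p, hp, -⟩ := exists_le_isAssociatedPrime_of_isNoetherianRing Λ (⟨x, hx⟩ : N)
    (by simpa [Subtype.ext_iff] using hx0)
  obtain ⟨hpp, ⟨z, hz⟩, hpz⟩ := isAssociatedPrime_iff.1 hp
  have hmem (i : Λ) : i ∈ p ↔ i • z = 0 := by
    rw [hpz, Submodule.mem_colon_singleton, Submodule.mem_bot, Subtype.ext_iff]
    rfl
  have hdim : ringKrullDim (Λ ⧸ p) + 2 ≤ ringKrullDim Λ := by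
    by_contra h
    obtain ⟨s, hs, hsz⟩ := hN p hpp (HeightLEOne.of_not_ringKrullDim_le h) z hz
    exact hs ((hmem s).2 hsz)
  obtain ⟨y, rfl⟩ := hφ z
  have hy : y ∈ LinearMap.ker φ := IsRegularLocalRing.mem_of_forall_smul_mem hdim fun i hi => by
    rw [LinearMap.mem_ker, map_smul, (hmem i).1 hi]
  refine hpp.ne_top ((Ideal.eq_top_iff_one _).2 ((hmem 1).2 ?_))
  rw [one_smul, LinearMap.mem_ker.1 hy]
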